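/- For every α ∈ (0, 1/2) and every positive integer T, there exist μ₁, μ₂ ∈ ℝ with |μ₁ − μ₂| ≥ 2α/√T and probability measures Q₁, Q₂ on ℝ^T such that (1−α) · N(μ₁,1)^{⊗T} + α · Q₁ = (1−α) · N(μ₂,1)^{⊗T} + α · Q₂ as measures on ℝ^T. -/

import Mathlib

open MeasureTheory ProbabilityTheory
open scoped ENNReal

/-- A finite power of a measure with density is the power of the measure with the product density. -/
theorem MeasureTheory.Measure.pi_withDensity {ι : Type*} [Fintype ι]
    {X : Type*} {mX : MeasurableSpace X}
    (ν : Measure X) [IsProbabilityMeasure ν] {f : X → ℝ≥0∞} (hf : Measurable f)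
    [SigmaFinite (ν.withDensity f)] :
    Measure.pi (fun _ : ι => ν.withDensity f)
      = (Measure.pi (fun _ : ι => ν)).withDensity (fun x => ∏ i, f (x i)) := by
  refine Measure.pi_eq fun s hs => ?_
  have hg : ∀ i, Measurable ((s i).indicator f) := fun i => hf.indicator (hs i)
  have hind : iIndepFun (fun i (x : ι → X) => (s i).indicator f (x i))
      (Measure.pi (fun _ : ι => ν)) :=
    iIndepFun_pi (X := fun i => (s i).indicator f) fun i => (hg i).aemeasurable
  rw [withDensity_apply _ (MeasurableSet.univ_pi hs),
    ← lintegral_indicator (MeasurableSet.univ_pi hs)]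
  calc ∫⁻ x, (Set.univ.pi s).indicator (fun x => ∏ i, f (x i)) x ∂Measure.pi (fun _ : ι => ν)
      = ∫⁻ x, ∏ i, (s i).indicator f (x i) ∂Measure.pi (fun _ : ι => ν) := by
        congr 1 with x
        by_cases hx : x ∈ Set.univ.pi s
        · rw [Set.indicator_of_mem hx]
          exact Finset.prod_congr rfl fun i _ =>
            (Set.indicator_of_mem (hx i (Set.mem_univ i)) f).symm
        · rw [Set.indicator_of_notMem hx]
          obtain ⟨i, hi⟩ : ∃ i, x i ∉ s i := by simpa [Set.mem_pi] using hx
          exact (Finset.prod_eq_zero (Finset.mem_univ i) (Set.indicator_of_notMem hi f)).symm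
    _ = ∏ i, ∫⁻ x, (s i).indicator f (x i) ∂Measure.pi (fun _ : ι => ν) :=
        lintegral_prod_eq_prod_lintegral_of_indepFun Finset.univ _ hind
          fun i => (hg i).comp (measurable_pi_apply i)
    _ = ∏ i, ν.withDensity f (s i) := by
        refine Finset.prod_congr rfl fun i _ => ?_
        rw [(measurePreserving_eval (fun _ : ι => ν) i).lintegral_comp (hg i),
          lintegral_indicator (hs i), withDensity_apply _ (hs i)]

theorem gaussianReal_eq_withDensity_exp (c : ℝ) :
    gaussianReal c 1 = (gaussianReal 0 1).withDensity
      (fun x => ENNReal.ofReal (Real.exp (c * x - c ^ 2 / 2))) := by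
  rw [gaussianReal_of_var_ne_zero _ one_ne_zero, gaussianReal_of_var_ne_zero _ one_ne_zero,
    ← withDensity_mul _ (measurable_gaussianPDF _ _) (by fun_prop)]
  congr 1 with x
  rw [Pi.mul_apply, gaussianPDF, gaussianPDF, ← ENNReal.ofReal_mul (gaussianPDFReal_nonneg _ _ _),
    gaussianPDFReal, gaussianPDFReal, mul_assoc _ (Real.exp _) (Real.exp _), ← Real.exp_add]
  congr 3
  simp only [NNReal.coe_one]
  ring

theorem integral_exp_mul_gaussianReal (t : ℝ) :
    ∫ x, Real.exp (t * x) ∂gaussianReal 0 1 = Real.exp (t ^ 2 / 2) := by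
  simpa [mgf] using mgf_gaussianReal (X := id) (μ := 0) (v := 1) (Measure.map_id) t

/-- A density with second moment at most `1 + s ^ 2` is within `s / 2` of `1` in total variation. -/
theorem lintegral_one_tsub_ofReal_le {X : Type*} {mX : MeasurableSpace X} (P : Measure X)
    [IsProbabilityMeasure P] {l : X → ℝ} (hl0 : ∀ x, 0 ≤ l x) (hl : Integrable l P)
    (hl2 : Integrable (fun x => l x ^ 2) P) (h1 : ∫ x, l x ∂P = 1) {s : ℝ} (hs : 0 < s)
    (h2 : ∫ x, l x ^ 2 ∂P ≤ 1 + s ^ 2) :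
    ∫⁻ x, (1 - ENNReal.ofReal (l x)) ∂P ≤ ENNReal.ofReal (s / 2) := by
  set A : ℝ := 1 / (4 * s) with hA
  set B : ℝ := (1 + s) / (2 * s) with hB
  set C : ℝ := (1 + s) ^ 2 / (4 * s) with hC
  have hint2 := hl2.const_mul A
  have hint1 := hl.const_mul B
  have hsub : Integrable (fun x => A * l x ^ 2 - B * l x) P := hint2.sub hint1
  have hint : Integrable (fun x => A * l x ^ 2 - B * l x + C) P := hsub.add (integrable_const C)
  have hpt : ∀ x, max (1 - l x) 0 ≤ A * l x ^ 2 - B * l x + C := by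
    intro x
    have hsq : A * l x ^ 2 - B * l x + C = (l x - 1 - s) ^ 2 / (4 * s) := by
      rw [hA, hB, hC]; field_simp; ring
    have hneg : (l x - 1 - s) ^ 2 / (4 * s) - (1 - l x) = (l x - 1 + s) ^ 2 / (4 * s) := by
      field_simp; ring
    have p : 0 ≤ (l x - 1 - s) ^ 2 / (4 * s) := by positivity
    have q : 0 ≤ (l x - 1 + s) ^ 2 / (4 * s) := by positivity
    rw [hsq]
    exact max_le (by linarith) p
  calc ∫⁻ x, (1 - ENNReal.ofReal (l x)) ∂P
      ≤ ∫⁻ x, ENNReal.ofReal (A * l x ^ 2 - B * l x + C) ∂P := by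
        refine lintegral_mono fun x => ?_
        rw [← ENNReal.ofReal_one, ← ENNReal.ofReal_sub _ (hl0 x)]
        exact ENNReal.ofReal_le_ofReal ((le_max_left _ _).trans (hpt x))
    _ = ENNReal.ofReal (∫ x, (A * l x ^ 2 - B * l x + C) ∂P) :=
        (ofReal_integral_eq_lintegral_ofReal hint
          (Filter.Eventually.of_forall fun x => (le_max_right _ _).trans (hpt x))).symm
    _ ≤ ENNReal.ofReal (s / 2) := by
        refine ENNReal.ofReal_le_ofReal ?_
        rw [integral_add hsub (integrable_const C), integral_sub hint2 hint1,
          integral_const_mul, integral_const_mul, h1, integral_const, probReal_univ, one_smul]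
        have hA0 : 0 ≤ A := by positivity
        calc A * ∫ x, l x ^ 2 ∂P - B * 1 + C ≤ A * (1 + s ^ 2) - B * 1 + C := by gcongr
          _ = s / 2 := by rw [hA, hB, hC]; field_simp; ring

/-- If the deficit of a probability density `f` below `1` has mass at most `b / a`, then `P` and
`f • P` can be contaminated by a `b` fraction so as to become equal. -/
theorem exists_contamination_eq {X : Type*} {mX : MeasurableSpace X} (P : Measure X)
    [IsProbabilityMeasure P] {f : X → ℝ≥0∞} (hf : Measurable f) (hf1 : ∫⁻ x, f x ∂P = 1)
    {a b : ℝ≥0∞} (hb0 : b ≠ 0) (hb : b ≠ ∞)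
    (h : a * ∫⁻ x, (1 - f x) ∂P ≤ b) :
    ∃ Q₁ Q₂ : Measure X, IsProbabilityMeasure Q₁ ∧ IsProbabilityMeasure Q₂ ∧
      a • P + b • Q₁ = a • P.withDensity f + b • Q₂ := by
  set d := ∫⁻ x, (1 - f x) ∂P
  have hd1 : d ≠ ∞ := by
    refine ne_top_of_le_ne_top ENNReal.one_ne_top (b := 1) ?_
    calc d ≤ ∫⁻ _, 1 ∂P := lintegral_mono fun x => tsub_le_self
      _ = 1 := by simp
  have hmax : ∀ x, 1 + (f x - 1) = f x + (1 - f x) := fun x => by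
    rw [add_tsub_eq_max, add_tsub_eq_max, max_comm]
  have hd' : ∫⁻ x, (f x - 1) ∂P = d := by
    have : 1 + ∫⁻ x, (f x - 1) ∂P = 1 + d := by
      calc 1 + ∫⁻ x, (f x - 1) ∂P = ∫⁻ x, (1 + (f x - 1)) ∂P := by
            rw [lintegral_add_left measurable_const]; simp
        _ = ∫⁻ x, (f x + (1 - f x)) ∂P := by simp_rw [hmax]
        _ = 1 + d := by rw [lintegral_add_left hf, hf1]
    exact (ENNReal.add_right_inj ENNReal.one_ne_top).1 this
  have hmeas : P + P.withDensity (fun x => f x - 1)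
      = P.withDensity f + P.withDensity (fun x => 1 - f x) := by
    calc P + P.withDensity (fun x => f x - 1)
        = P.withDensity 1 + P.withDensity (fun x => f x - 1) := by rw [withDensity_one]
      _ = P.withDensity f + P.withDensity (fun x => 1 - f x) := by
        rw [← withDensity_add_left measurable_one, ← withDensity_add_left hf]
        exact congrArg _ (funext hmax)
  have hprob : ∀ g : X → ℝ≥0∞, ∫⁻ x, g x ∂P = d →
      IsProbabilityMeasure (b⁻¹ • (a • P.withDensity g + (b - a * d) • P)) := fun g hg => by
    constructor
    simp only [Measure.smul_apply, Measure.add_apply, smul_eq_mul, measure_univ, mul_one,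
      withDensity_apply _ MeasurableSet.univ, Measure.restrict_univ, hg]
    rw [add_tsub_cancel_of_le h, ENNReal.inv_mul_cancel hb0 hb]
  refine ⟨_, _, hprob _ hd', hprob _ rfl, ?_⟩
  rw [smul_smul, smul_smul, ENNReal.mul_inv_cancel hb0 hb, one_smul, one_smul, ← add_assoc,
    ← add_assoc, ← smul_add, ← smul_add, hmeas]

theorem exp_four_mul_sq_le {α : ℝ} (hα0 : 0 < α) (hα1 : α < 1 / 2) :
    Real.exp (4 * α ^ 2) ≤ 1 + (2 * (α / (1 - α))) ^ 2 := by
  have hx : 4 * α ^ 2 ≤ 1 := by nlinarith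
  have h := (abs_le.1 (Real.abs_exp_sub_one_sub_id_le
    (abs_le.2 ⟨by nlinarith [sq_nonneg α], hx⟩))).2
  have h3 : (1 + 4 * α ^ 2) * (1 - α) ^ 2 ≤ 1 := by
    have : 1 - (1 + 4 * α ^ 2) * (1 - α) ^ 2 = α * (2 - 5 * α + 8 * α ^ 2 - 4 * α ^ 3) := by ring
    have : 0 ≤ 2 - 5 * α + 8 * α ^ 2 - 4 * α ^ 3 := by
      nlinarith [sq_nonneg (α - 5 / 12), mul_nonneg (sq_nonneg α) (sub_nonneg.2 hα1.le)]
    nlinarith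
  have h4 : 1 + 4 * α ^ 2 ≤ 1 / (1 - α) ^ 2 := by
    rw [le_div_iff₀ (by nlinarith)]; exact h3
  calc Real.exp (4 * α ^ 2) ≤ 1 + 4 * α ^ 2 * (1 + 4 * α ^ 2) := by nlinarith
    _ ≤ 1 + 4 * α ^ 2 * (1 / (1 - α) ^ 2) := by gcongr
    _ = 1 + (2 * (α / (1 - α))) ^ 2 := by rw [mul_pow, div_pow]; ring

/-- For every `α ∈ (0, 1/2)` and horizon `T`, there are means
`μ₁, μ₂` with `|μ₁ − μ₂| ≥ 2α/√T` and probability measures `Q₁, Q₂` on `ℝ^T` such that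
`(1−α) N(μ₁,1)^{⊗T} + α Q₁ = (1−α) N(μ₂,1)^{⊗T} + α Q₂`. -/
theorem stmt11 (α : ℝ) (hα0 : 0 < α) (hα1 : α < 1 / 2) (T : ℕ) (hT : 0 < T) :
    ∃ μ₁ μ₂ : ℝ, |μ₁ - μ₂| ≥ 2 * α / Real.sqrt T ∧
      ∃ Q₁ Q₂ : Measure (Fin T → ℝ),
        IsProbabilityMeasure Q₁ ∧ IsProbabilityMeasure Q₂ ∧
        ENNReal.ofReal (1 - α) • Measure.pi (fun _ : Fin T => gaussianReal μ₁ 1)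
            + ENNReal.ofReal α • Q₁
          = ENNReal.ofReal (1 - α) • Measure.pi (fun _ : Fin T => gaussianReal μ₂ 1)
            + ENNReal.ofReal α • Q₂ := by
  set c : ℝ := 2 * α / Real.sqrt T with hc
  have hT' : (0 : ℝ) < T := by exact_mod_cast hT
  have hcT : T * c ^ 2 = 4 * α ^ 2 := by
    rw [hc, div_pow, Real.sq_sqrt hT'.le]; field_simp; ring
  have hα : 0 < 1 - α := by linarith
  set g : ℝ → ℝ := fun x => Real.exp (c * x - c ^ 2 / 2) with hg
  have hgi : Integrable g (gaussianReal 0 1) := by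
    simpa only [hg, Real.exp_sub] using (integrable_exp_mul_gaussianReal c).div_const _
  have hg2 : (fun x => g x ^ 2) = fun x => Real.exp (2 * c * x) / Real.exp (c ^ 2) := by
    ext x; rw [← Real.exp_sub, ← Real.exp_nat_mul]; congr 1; push_cast; ring
  have hgi2 : Integrable (fun x => g x ^ 2) (gaussianReal 0 1) :=
    hg2 ▸ (integrable_exp_mul_gaussianReal (2 * c)).div_const _
  have hgint : ∫ x, g x ∂gaussianReal 0 1 = 1 := by
    simp_rw [hg, Real.exp_sub]
    rw [integral_div, integral_exp_mul_gaussianReal, div_self (Real.exp_pos _).ne']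
  have hgint2 : ∫ x, g x ^ 2 ∂gaussianReal 0 1 = Real.exp (c ^ 2) := by
    rw [hg2, integral_div, integral_exp_mul_gaussianReal, ← Real.exp_sub]; congr 1; ring
  have hprod : ∀ x : Fin T → ℝ, ∏ i, ENNReal.ofReal (g (x i)) = ENNReal.ofReal (∏ i, g (x i)) :=
    fun x => (ENNReal.ofReal_prod_of_nonneg fun i _ => (Real.exp_pos _).le).symm
  have hl0 : ∀ x : Fin T → ℝ, 0 ≤ ∏ i, g (x i) :=
    fun x => Finset.prod_nonneg fun i _ => (Real.exp_pos _).le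
  have hpi : Measure.pi (fun _ : Fin T => gaussianReal c 1)
      = (Measure.pi (fun _ : Fin T => gaussianReal 0 1)).withDensity
        (fun x => ENNReal.ofReal (∏ i, g (x i))) := by
    have hs : SigmaFinite ((gaussianReal 0 1).withDensity (fun x => ENNReal.ofReal (g x))) := by
      rw [← gaussianReal_eq_withDensity_exp]; infer_instance
    simp_rw [← hprod]
    rw [← Measure.pi_withDensity (f := fun x => ENNReal.ofReal (g x)) _ (by fun_prop),
      ← gaussianReal_eq_withDensity_exp]
  have hli : Integrable (fun x : Fin T → ℝ => ∏ i, g (x i))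
      (Measure.pi (fun _ : Fin T => gaussianReal 0 1)) := Integrable.fintype_prod fun _ => hgi
  have hli2 : Integrable (fun x : Fin T → ℝ => (∏ i, g (x i)) ^ 2)
      (Measure.pi (fun _ : Fin T => gaussianReal 0 1)) := by
    simp_rw [← Finset.prod_pow]
    exact Integrable.fintype_prod (f := fun _ x => g x ^ 2) fun _ => hgi2
  have hl1 : ∫ x : Fin T → ℝ, ∏ i, g (x i) ∂Measure.pi (fun _ => gaussianReal 0 1) = 1 := by
    rw [integral_fintype_prod_eq_pow, hgint, one_pow]
  have hl2 : ∫ x : Fin T → ℝ, (∏ i, g (x i)) ^ 2 ∂Measure.pi (fun _ => gaussianReal 0 1)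
      ≤ 1 + (2 * (α / (1 - α))) ^ 2 := by
    simp_rw [← Finset.prod_pow]
    rw [integral_fintype_prod_eq_pow (fun x => g x ^ 2), hgint2, ← Real.exp_nat_mul,
      Fintype.card_fin, hcT]
    exact exp_four_mul_sq_le hα0 hα1
  refine ⟨0, c, ?_, ?_⟩
  · rw [zero_sub, abs_neg]
    exact le_abs_self c
  rw [hpi]
  refine exists_contamination_eq _ (by fun_prop) ?_ (by simpa using hα0) ENNReal.ofReal_ne_top ?_
  · rw [← ofReal_integral_eq_lintegral_ofReal hli (Filter.Eventually.of_forall hl0), hl1,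
      ENNReal.ofReal_one]
  · have h := lintegral_one_tsub_ofReal_le _ hl0 hli hli2 hl1 (s := 2 * (α / (1 - α)))
      (by positivity) hl2
    calc ENNReal.ofReal (1 - α) * _ ≤ ENNReal.ofReal (1 - α) * _ := mul_le_mul_right h _
      _ = ENNReal.ofReal α := by
        rw [← ENNReal.ofReal_mul hα.le]; congr 1; field_simp
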